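/- Let a, b, k, d be positive integers with a, b ≥ 2, k ≥ 1, gcd(a,b) = 1, and d dividing a. Let S = ⟨Geom(a,b;k)⟩ and let N be the number of gaps of S divisible by d. Then, as an equality of integers, 2·(b − a)·d·N = (a − 1)·b^{k+1} − (b − 1)·a^{k+1} + (b − a)·d + (b − a)·(1 − d)·b^k. -/

import Mathlib

/-- The numerical semigroup generated by the geometric sequence
`a^k, a^(k-1)*b, …, b^k`. -/
def geomNS (a b k : ℕ) : AddSubmonoid ℕ :=
  AddSubmonoid.closure ((fun i => a ^ (k - i) * b ^ i) '' Set.Iic k)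

theorem geomNS_zero (a b : ℕ) : geomNS a b 0 = ⊤ := by
  rw [eq_top_iff]
  intro n _
  have h1 : 1 ∈ geomNS a b 0 := AddSubmonoid.subset_closure ⟨0, by simp, by simp⟩
  simpa using nsmul_mem h1 n

theorem pow_right_mem_geomNS (a b k : ℕ) : b ^ k ∈ geomNS a b k :=
  AddSubmonoid.subset_closure ⟨k, by simp, by simp⟩

theorem mul_mem_geomNS_succ {a b k s : ℕ} (hs : s ∈ geomNS a b k) :
    a * s ∈ geomNS a b (k + 1) := by
  induction hs using AddSubmonoid.closure_induction with
  | mem x hx =>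
    obtain ⟨i, hi, rfl⟩ := hx
    have hi : i ≤ k := hi
    refine AddSubmonoid.subset_closure ⟨i, Set.mem_Iic.2 (by omega), ?_⟩
    simp only [Nat.succ_sub hi, pow_succ]
    ring
  | zero => simp
  | add x y _ _ hx hy => rw [mul_add]; exact add_mem hx hy

theorem exists_of_mem_geomNS_succ {a b k n : ℕ} (hn : n ∈ geomNS a b (k + 1)) :
    ∃ s ∈ geomNS a b k, ∃ t, n = a * s + t * b ^ (k + 1) := by
  induction hn using AddSubmonoid.closure_induction with
  | mem x hx =>
    obtain ⟨i, hi, rfl⟩ := hx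
    have hi : i ≤ k + 1 := hi
    rcases hi.eq_or_lt with rfl | hi
    · exact ⟨0, zero_mem _, 1, by simp⟩
    · have hi : i ≤ k := by omega
      refine ⟨a ^ (k - i) * b ^ i, AddSubmonoid.subset_closure ⟨i, hi, rfl⟩, 0, ?_⟩
      simp only [Nat.succ_sub hi, pow_succ]
      ring
  | zero => exact ⟨0, zero_mem _, 0, by simp⟩
  | add x y _ _ hx hy =>
    obtain ⟨s, hs, t, rfl⟩ := hx
    obtain ⟨s', hs', t', rfl⟩ := hy
    exact ⟨s + s', add_mem hs hs', t + t', by ring⟩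

theorem mem_geomNS_succ_iff {a b k n : ℕ} (ha : 0 < a) :
    n ∈ geomNS a b (k + 1) ↔
      ∃ s ∈ geomNS a b k, ∃ t < a, n = a * s + t * b ^ (k + 1) := by
  constructor
  · intro hn
    obtain ⟨s, hs, t, rfl⟩ := exists_of_mem_geomNS_succ hn
    refine ⟨s + (t / a * b) • b ^ k, add_mem hs (nsmul_mem (pow_right_mem_geomNS a b k) _),
      t % a, Nat.mod_lt _ ha, ?_⟩
    conv_lhs => rw [← Nat.div_add_mod t a]
    rw [smul_eq_mul]
    ring
  · rintro ⟨s, hs, t, -, rfl⟩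
    exact add_mem (mul_mem_geomNS_succ hs)
      (by simpa using nsmul_mem (pow_right_mem_geomNS a b (k + 1)) t)

theorem eq_of_mul_add_mul_eq {a c : ℕ} (hac : a.Coprime c) {m m' : ℤ} {j j' : ℕ}
    (hj : j < a) (hj' : j' < a) (h : (a : ℤ) * m + j * c = a * m' + j' * c) :
    m = m' ∧ j = j' := by
  have hdvd : (a : ℤ) ∣ (j - j') * c := ⟨m' - m, by linarith⟩
  have hdvd : (a : ℤ) ∣ j - j' :=
    IsCoprime.dvd_of_dvd_mul_right (Nat.isCoprime_iff_coprime.2 hac) hdvd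
  have hjj : (j : ℤ) - j' = 0 :=
    Int.eq_zero_of_abs_lt_dvd hdvd (by rw [abs_lt]; constructor <;> omega)
  have hjj : j = j' := by omega
  subst hjj
  refine ⟨?_, rfl⟩
  have ha : (a : ℤ) ≠ 0 := by omega
  exact mul_left_cancel₀ ha (by linarith)

theorem exists_lt_eq_mul_add_mul {a c : ℕ} (ha : 0 < a) (hac : a.Coprime c) (n : ℕ) :
    ∃ j < a, ∃ m : ℤ, (n : ℤ) = a * m + j * c := by
  obtain ⟨u, v, huv⟩ := Nat.isCoprime_iff_coprime.2 hac
  have ha' : (a : ℤ) ≠ 0 := by omega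
  have h0 := Int.emod_nonneg (n * v) ha'
  have h1 := Int.emod_lt_of_pos (n * v) (by omega : (0 : ℤ) < a)
  have h2 := Int.mul_ediv_add_emod (n * v) a
  refine ⟨((n * v) % a : ℤ).toNat, by omega, n * u + c * ((n * v) / a), ?_⟩
  rw [Int.toNat_of_nonneg h0]
  linear_combination (-(n : ℤ)) * huv - c * h2

theorem two_mul_sum_mul_div {m c : ℕ} (hm : 0 < m) (hmc : m.Coprime c) :
    2 * ((∑ i : Fin m, i * c / m : ℕ) : ℤ) = (m - 1) * (c - 1) := by
  have hperm : ∑ i ∈ Finset.range m, i * c % m = ∑ i ∈ Finset.range m, i := by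
    have hinj : Set.InjOn (fun i => i * c % m) (Finset.range m) := by
      intro i hi j hj hij
      have hij : i * c ≡ j * c [MOD m] := hij
      have := Nat.ModEq.cancel_right_of_coprime hmc hij
      exact this.eq_of_lt_of_lt (by simpa using hi) (by simpa using hj)
    have himg : (Finset.range m).image (fun i => i * c % m) = Finset.range m := by
      apply Finset.eq_of_subset_of_card_le
      · intro x hx
        obtain ⟨i, -, rfl⟩ := Finset.mem_image.1 hx
        exact Finset.mem_range.2 (Nat.mod_lt _ hm)
      · rw [Finset.card_image_of_injOn hinj]
    conv_rhs => rw [← himg, Finset.sum_image hinj]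
  rw [Fin.sum_univ_eq_sum_range (fun i => i * c / m) m]
  have hdiv : m * ∑ i ∈ Finset.range m, i * c / m + ∑ i ∈ Finset.range m, i =
      (∑ i ∈ Finset.range m, i) * c := by
    rw [← hperm, Finset.mul_sum, ← Finset.sum_add_distrib, hperm, Finset.sum_mul]
    exact Finset.sum_congr rfl fun i _ => Nat.div_add_mod _ _
  have hgauss := Finset.sum_range_id_mul_two m
  zify [Nat.one_le_iff_ne_zero.2 hm.ne'] at hdiv hgauss ⊢
  have hm' : (m : ℤ) ≠ 0 := by omega
  apply mul_left_cancel₀ hm'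
  linear_combination 2 * hdiv + (c - 1) * hgauss

/-- Writing an integer uniquely as `a * m + j * b ^ (k + 1)` with `j < a`, the gaps of
`geomNS a b (k + 1)` divisible by `d` are those with `d ∣ j` and `m` either a gap of
`geomNS a b k` or negative. -/
theorem nonempty_gaps_equiv {a b : ℕ} (k d e : ℕ) (hde : a = d * e) (ha : 0 < a)
    (hab : a.Coprime b) :
    Nonempty ((Σ i : Fin e, {n : ℕ // n ∉ geomNS a b k} ⊕ Fin (i * b ^ (k + 1) / e)) ≃
      {n : ℕ // n ∉ geomNS a b (k + 1) ∧ d ∣ n}) := by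
  have hac : a.Coprime (b ^ (k + 1)) := hab.pow_right _
  have hmem := @mem_geomNS_succ_iff a b k (ha := ha)
  generalize b ^ (k + 1) = c at *
  have hd : 0 < d := Nat.pos_of_mul_pos_right (hde ▸ ha)
  have he : 0 < e := Nat.pos_of_mul_pos_left (hde ▸ ha)
  let q (x : Σ i : Fin e, {n : ℕ // n ∉ geomNS a b k} ⊕ Fin (i * c / e)) : ℤ :=
    Sum.elim (fun m => (m.1 : ℤ)) (fun t => -((t.1 : ℤ) + 1)) x.2
  have hlt (i : Fin e) : d * i < a := hde ▸ (Nat.mul_lt_mul_left hd).2 i.2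
  have hnonneg (x) : 0 ≤ a * q x + (d * x.1 : ℕ) * c := by
    obtain ⟨i, m | t⟩ := x
    · simp only [q, Sum.elim_inl]; positivity
    · simp only [q, Sum.elim_inr]
      have := (Nat.le_div_iff_mul_le he).1 (Nat.succ_le_of_lt t.2)
      rw [hde]
      zify at this
      push_cast
      nlinarith
  have hgap (x) : (a * q x + (d * x.1 : ℕ) * c).toNat ∉ geomNS a b (k + 1) := by
    rw [hmem]
    rintro ⟨s, hs, t, ht, h⟩
    rw [← Int.natCast_inj, Int.toNat_of_nonneg (hnonneg x)] at h
    rw [Nat.cast_add, Nat.cast_mul, Nat.cast_mul] at h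
    obtain ⟨h1, -⟩ := eq_of_mul_add_mul_eq hac (hlt _) ht h
    obtain ⟨i, m | t⟩ := x
    · simp only [q, Sum.elim_inl, Nat.cast_inj] at h1
      exact m.2 (h1 ▸ hs)
    · simp only [q, Sum.elim_inr] at h1
      omega
  have hdvd (x) : d ∣ (a * q x + (d * x.1 : ℕ) * c).toNat := by
    rw [← Int.natCast_dvd_natCast, Int.toNat_of_nonneg (hnonneg x)]
    have hde : (a : ℤ) = d * e := by exact_mod_cast hde
    exact ⟨e * q x + x.1 * c, by push_cast; linear_combination q x * hde⟩
  refine ⟨Equiv.ofBijective (fun x => ⟨_, hgap x, hdvd x⟩) ⟨?_, ?_⟩⟩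
  · intro x y hxy
    have h := congrArg (fun z => ((z.1 : ℕ) : ℤ)) hxy
    simp only [Int.toNat_of_nonneg (hnonneg _)] at h
    obtain ⟨h1, h2⟩ := eq_of_mul_add_mul_eq hac (hlt _) (hlt _) h
    obtain ⟨i, m⟩ := x
    obtain ⟨j, m'⟩ := y
    obtain rfl : i = j := Fin.ext (Nat.eq_of_mul_eq_mul_left hd h2)
    rcases m with m | t <;> rcases m' with m' | t' <;>
      simp only [q, Sum.elim_inl, Sum.elim_inr] at h1
    · obtain rfl : m = m' := Subtype.ext (by omega)
      rfl
    · omega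
    · omega
    · obtain rfl : t = t' := Fin.ext (by omega)
      rfl
  · rintro ⟨n, hn, hdn⟩
    obtain ⟨j, hj, m, hm⟩ := exists_lt_eq_mul_add_mul ha hac n
    have hdj : d ∣ j := by
      have hdc : d.Coprime c := Nat.Coprime.coprime_dvd_left ⟨e, hde⟩ hac
      refine hdc.dvd_of_dvd_mul_right ?_
      have h1 : (d : ℤ) ∣ n := by exact_mod_cast hdn
      have h2 : (d : ℤ) ∣ a * m := Dvd.dvd.mul_right (Int.natCast_dvd_natCast.2 ⟨e, hde⟩) m
      zify
      rw [hm] at h1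
      exact (dvd_add_right h2).1 h1
    obtain ⟨i, rfl⟩ := hdj
    have hi : i < e := by rw [hde] at hj; exact Nat.lt_of_mul_lt_mul_left hj
    obtain ⟨y, hy⟩ : ∃ y : {n : ℕ // n ∉ geomNS a b k} ⊕ Fin (i * c / e),
        Sum.elim (fun m => (m.1 : ℤ)) (fun t => -((t.1 : ℤ) + 1)) y = m := by
      rcases le_or_gt 0 m with h0 | h0
      · lift m to ℕ using h0
        refine ⟨.inl ⟨m, fun hs => hn ((hmem n).2 ⟨m, hs, d * i, hj, by exact_mod_cast hm⟩)⟩, rfl⟩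
      · obtain ⟨t, rfl⟩ : ∃ t : ℕ, m = -(t + 1 : ℤ) := ⟨(-m - 1).toNat, by omega⟩
        refine ⟨.inr ⟨t, (Nat.le_div_iff_mul_le he).2 ?_⟩, rfl⟩
        refine Nat.le_of_mul_le_mul_left ?_ hd
        rw [hde] at hm
        zify
        push_cast at hm ⊢
        nlinarith
    refine ⟨⟨⟨i, hi⟩, y⟩, Subtype.ext ?_⟩
    rw [← Int.natCast_inj, Int.toNat_of_nonneg (hnonneg _)]
    simp only [q, hy, hm]

theorem finite_gaps_geomNS {a b : ℕ} (k : ℕ) (ha : 0 < a) (hab : a.Coprime b) :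
    Finite {n : ℕ // n ∉ geomNS a b k} := by
  induction k with
  | zero =>
    rw [geomNS_zero]
    have : IsEmpty {n : ℕ // n ∉ (⊤ : AddSubmonoid ℕ)} := ⟨fun x => x.2 trivial⟩
    infer_instance
  | succ k ih =>
    obtain ⟨f⟩ := nonempty_gaps_equiv k 1 a (one_mul a).symm ha hab
    have := Finite.of_equiv _ f
    simpa using this

theorem two_mul_card_gaps_dvd_succ {a b : ℕ} (k d e : ℕ) (hde : a = d * e) (ha : 0 < a)
    (hab : a.Coprime b) :
    2 * (Nat.card {n : ℕ // n ∉ geomNS a b (k + 1) ∧ d ∣ n} : ℤ) =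
      e * (2 * Nat.card {n : ℕ // n ∉ geomNS a b k}) + (e - 1) * ((b : ℤ) ^ (k + 1) - 1) := by
  obtain ⟨f⟩ := nonempty_gaps_equiv k d e hde ha hab
  have := finite_gaps_geomNS k ha hab
  have hec : e.Coprime (b ^ (k + 1)) :=
    (Nat.Coprime.coprime_dvd_left ⟨d, by rw [hde, mul_comm]⟩ hab).pow_right _
  have hsum := two_mul_sum_mul_div (Nat.pos_of_mul_pos_left (hde ▸ ha)) hec
  rw [← Nat.card_congr f, Nat.card_sigma]
  simp only [Nat.card_sum, Nat.card_fin, Finset.sum_add_distrib, Finset.sum_const,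
    Finset.card_univ, Fintype.card_fin, smul_eq_mul]
  push_cast at hsum ⊢
  linear_combination hsum

theorem two_mul_card_gaps {a b : ℕ} (k : ℕ) (ha : 0 < a) (hab : a.Coprime b) :
    ((b : ℤ) - a) * (2 * Nat.card {n : ℕ // n ∉ geomNS a b k}) =
      ((a : ℤ) - 1) * (b : ℤ) ^ (k + 1) - ((b : ℤ) - 1) * (a : ℤ) ^ (k + 1) + (b - a) := by
  induction k with
  | zero =>
    rw [geomNS_zero]
    have : IsEmpty {n : ℕ // n ∉ (⊤ : AddSubmonoid ℕ)} := ⟨fun x => x.2 trivial⟩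
    rw [Nat.card_of_isEmpty]
    push_cast
    ring
  | succ k ih =>
    have h := two_mul_card_gaps_dvd_succ k 1 a (one_mul a).symm ha hab
    simp only [one_dvd, and_true] at h
    rw [h]
    linear_combination (a : ℤ) * ih

theorem stmt_19 (a b k d : ℕ) (ha : 2 ≤ a) (hb : 2 ≤ b) (hk : 1 ≤ k) (hd : 0 < d)
    (hab : Nat.Coprime a b) (hda : d ∣ a)
    (N : ℕ) (hN : N = Nat.card {n : ℕ // n ∉ geomNS a b k ∧ d ∣ n}) :
    2 * ((b : ℤ) - (a : ℤ)) * (d : ℤ) * (N : ℤ) =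
      ((a : ℤ) - 1) * (b : ℤ) ^ (k + 1) - ((b : ℤ) - 1) * (a : ℤ) ^ (k + 1)
        + ((b : ℤ) - (a : ℤ)) * d
        + ((b : ℤ) - (a : ℤ)) * (1 - (d : ℤ)) * (b : ℤ) ^ k := by
  obtain ⟨k, rfl⟩ := Nat.exists_eq_add_of_le' hk
  obtain ⟨e, he⟩ := hda
  have h := two_mul_card_gaps_dvd_succ k d e he (by omega) hab
  have h' := two_mul_card_gaps k (by omega) hab
  rw [← hN] at h
  have he' : (a : ℤ) = d * e := by exact_mod_cast he
  linear_combination ((b : ℤ) - a) * d * h + (a : ℤ) * h' +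
    (-(b - a) * (2 * (Nat.card {n : ℕ // n ∉ geomNS a b k} : ℤ)) -
      (b - a) * ((b : ℤ) ^ (k + 1) - 1)) * he'
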